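/- Stabilizer transfer between a partition: with n = h + m, G = Matrix.fromBlocks G_H Γᵀ Γ G_M as in the context, and x : Fin n → ZMod 2 written as x = x_H ⧺ x_M, set y := G ·ᵥ x and write y = y_H ⧺ y_M. Let A_H be the operator acting only on the first group of h qubits by X^{x_H} Z^{y_H}, i.e. (A_H ψ)(s,t) = (−1)^{⟨y_H, s + x_H⟩} ψ(s + x_H, t), and let A_M be the operator acting only on the second group of m qubits by X^{x_M} Z^{y_M}, i.e. (A_M ψ)(s,t) = (−1)^{⟨y_M, t + x_M⟩} ψ(s, t + x_M). Then A_M |G⟩ = (−1)^{Q_G(x) + ⟨x_M, y_M⟩} • (A_H |G⟩): applying the M-part of the stabilizer of x to the graph state equals, up to this explicit global sign, applying its H-part. -/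

import Mathlib

open Matrix

/-- The sign `(−1)^u` for `u : ZMod 2`. -/
noncomputable def sgn (u : ZMod 2) : ℂ := if u = 0 then 1 else -1

/-- The quadratic form `Q_G(s) = ∑_{i < j} G i j * s i * s j` of a graph. -/
def qform {n : ℕ} (G : Matrix (Fin n) (Fin n) (ZMod 2)) (s : Fin n → ZMod 2) : ZMod 2 :=
  ∑ i : Fin n, ∑ j : Fin n, if i < j then G i j * s i * s j else 0

/-- The graph state `|G⟩(s) = 2^(−n/2) · (−1)^(Q_G(s))`. -/
noncomputable def graphState {n : ℕ} (G : Matrix (Fin n) (Fin n) (ZMod 2))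
    (s : Fin n → ZMod 2) : ℂ :=
  (((Real.sqrt 2)⁻¹ ^ n : ℝ) : ℂ) * sgn (qform G s)

/-- The inner product `⟨z, s⟩ = ∑ i, z i * s i` in `ZMod 2`. -/
def inn {n : ℕ} (z s : Fin n → ZMod 2) : ZMod 2 := ∑ i, z i * s i

/-- Concatenation of bit vectors along `finSumFinEquiv`. -/
def cat {h m : ℕ} (s : Fin h → ZMod 2) (t : Fin m → ZMod 2) : Fin (h + m) → ZMod 2 :=
  fun i => Sum.elim s t (finSumFinEquiv.symm i)

lemma sgn_add (a b : ZMod 2) : sgn (a + b) = sgn a * sgn b := by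
  have h2 : (1 + 1 : ZMod 2) = 0 := by decide
  have h1 : (1 : ZMod 2) ≠ 0 := by decide
  have key : ∀ c : ZMod 2, c = 0 ∨ c = 1 := by decide
  rcases key a with rfl | rfl <;> rcases key b with rfl | rfl <;> simp [sgn, h2]

lemma qform_add {n : ℕ} (G : Matrix (Fin n) (Fin n) (ZMod 2)) (hs : ∀ i j, G i j = G j i)
    (hd : ∀ i, G i i = 0) (a b : Fin n → ZMod 2) :
    qform G (a + b) = qform G a + qform G b + inn (G.mulVec b) a := by
  have h1 : inn (G.mulVec b) a = (∑ i, ∑ j, if i < j then G i j * b j * a i else 0)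
      + ∑ i, ∑ j, if j < i then G i j * b j * a i else 0 := by
    simp only [inn, Matrix.mulVec, dotProduct, Finset.sum_mul, ← Finset.sum_add_distrib]
    refine Finset.sum_congr rfl fun i _ => Finset.sum_congr rfl fun j _ => ?_
    rcases lt_trichotomy i j with h | h | h
    · simp [h, h.not_gt]
    · subst h; simp [hd]
    · simp [h, h.not_gt]
  rw [h1, Finset.sum_comm (f := fun i j => if j < i then G i j * b j * a i else 0)]
  simp only [qform, ← Finset.sum_add_distrib]
  refine Finset.sum_congr rfl fun i _ => Finset.sum_congr rfl fun j _ => ?_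
  split_ifs
  · rw [hs j i]; simp only [Pi.add_apply]; ring
  · simp

lemma inn_cat {h m : ℕ} (y : Fin (h + m) → ZMod 2) (s : Fin h → ZMod 2) (t : Fin m → ZMod 2) :
    inn y (cat s t) = inn (fun i => y (finSumFinEquiv (Sum.inl i))) s
      + inn (fun j => y (finSumFinEquiv (Sum.inr j))) t := by
  simp only [inn, cat]
  rw [← Equiv.sum_comp finSumFinEquiv, Fintype.sum_sum_type]
  simp only [Equiv.symm_apply_apply, Sum.elim_inl, Sum.elim_inr]

lemma inn_add {n : ℕ} (y a b : Fin n → ZMod 2) : inn y (a + b) = inn y a + inn y b := by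
  simp [inn, mul_add, Finset.sum_add_distrib]

lemma inn_comm {n : ℕ} (a b : Fin n → ZMod 2) : inn a b = inn b a := by
  simp [inn, mul_comm]

/-- Stabilizer transfer between the parts of a partition: applying the `M`-part
`A_M = X^{x_M} Z^{y_M}` of the stabilizer of `x` to the graph state equals, up to the
global sign `(−1)^{Q_G(x) + ⟨x_M, y_M⟩}`, applying its `H`-part `A_H = X^{x_H} Z^{y_H}`. -/
theorem stmt10 {h m : ℕ}
    (GH : Matrix (Fin h) (Fin h) (ZMod 2)) (hGHs : GH.IsSymm) (hGHd : ∀ i, GH i i = 0)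
    (GM : Matrix (Fin m) (Fin m) (ZMod 2)) (hGMs : GM.IsSymm) (hGMd : ∀ i, GM i i = 0)
    (Γ : Matrix (Fin m) (Fin h) (ZMod 2))
    (G : Matrix (Fin (h + m)) (Fin (h + m)) (ZMod 2))
    (hG : G = (Matrix.fromBlocks GH Γᵀ Γ GM).submatrix
        (⇑finSumFinEquiv.symm) (⇑finSumFinEquiv.symm))
    (xH : Fin h → ZMod 2) (xM : Fin m → ZMod 2) :
    let x : Fin (h + m) → ZMod 2 := cat xH xM
    let y : Fin (h + m) → ZMod 2 := G.mulVec x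
    let yH : Fin h → ZMod 2 := fun i => y (finSumFinEquiv (Sum.inl i))
    let yM : Fin m → ZMod 2 := fun j => y (finSumFinEquiv (Sum.inr j))
    ∀ (s : Fin h → ZMod 2) (t : Fin m → ZMod 2),
      sgn (inn yM (t + xM)) * graphState G (cat s (t + xM))
        = sgn (qform G x + inn xM yM) *
            (sgn (inn yH (s + xH)) * graphState G (cat (s + xH) t)) := by
  intro x y yH yM s t
  have hs : ∀ i j, G i j = G j i := by
    intro i j
    subst hG
    simp only [Matrix.submatrix_apply]
    rcases finSumFinEquiv.symm i with a | a <;> rcases finSumFinEquiv.symm j with b | b <;>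
      simp [hGHs.apply, hGMs.apply]
  have hd : ∀ i, G i i = 0 := by
    intro i
    subst hG
    simp only [Matrix.submatrix_apply]
    rcases finSumFinEquiv.symm i with a | a <;> simp [hGHd, hGMd]
  have hv : cat (s + xH) t = cat s (t + xM) + x := by
    funext i
    simp only [x, cat, Pi.add_apply]
    rcases finSumFinEquiv.symm i with a | a
    · simp
    · simp [add_assoc, CharTwo.add_self_eq_zero]
  have hxx : inn y x = 0 := by
    have h := qform_add G hs hd x x
    have h0 : x + x = 0 := by funext i; exact CharTwo.add_self_eq_zero _
    rw [h0, CharTwo.add_self_eq_zero, zero_add] at h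
    rw [← show qform G 0 = inn y x from h]
    simp [qform]
  have e1 : inn yH xH + inn yM xM = 0 := by rw [← hxx]; exact (inn_cat y xH xM).symm
  have e2 : qform G (cat (s + xH) t)
      = qform G (cat s (t + xM)) + qform G x + (inn yH s + inn yM (t + xM)) := by
    rw [hv, qform_add G hs hd]; congr 1; exact inn_cat y s (t + xM)
  have key : inn yM (t + xM) + qform G (cat s (t + xM))
      = (qform G x + inn xM yM) + (inn yH (s + xH) + qform G (cat (s + xH) t)) := by
    rw [e2, inn_comm xM yM, inn_add yH]
    have c1 := CharTwo.add_self_eq_zero (qform G x)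
    have c2 := CharTwo.add_self_eq_zero (inn yH s)
    linear_combination -e1 - c1 - c2
  have k2 := congrArg sgn key
  rw [sgn_add, sgn_add (_ + _) (_ + _), sgn_add (inn yH (s + xH))] at k2
  simp only [graphState]
  linear_combination (((Real.sqrt 2)⁻¹ ^ (h + m) : ℝ) : ℂ) * k2
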